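/- arXiv:1808.09694 — 6 statements merged into one kernel-verified Lean document; each statement's English description precedes it below -/
import Mathlib

section
/- Let r ≥ 1, m ≥ 1 be integers and set ℓ = r(r+2). Let U be an m×m complex matrix with exactly one nonzero entry in each row and exactly one nonzero entry in each column, all nonzero entries being ℓ-th roots of unity. Then (U^σ)ᵀ · U equals the identity matrix, where U^σ is obtained from U by applying the map z ↦ z^{r+1} to every entry, if and only if every nonzero entry a of U satisfies a^{r+2} = 1. -/
open Matrix

/-- The `j`-th diagonal entry of `(U^σ)ᵀ * U`, when the only nonzero entry of column `j`
lies in row `i`. -/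
theorem Matrix.transpose_map_pow_mul_apply_self {n R : Type*} [Fintype n] [Semiring R]
    (U : Matrix n n R) (k : ℕ) {i j : n} (h : ∀ i', U i' j ≠ 0 → i' = i) :
    ((U.map (fun z => z ^ k))ᵀ * U) j j = U i j ^ (k + 1) := by
  rw [mul_apply, Finset.sum_eq_single i]
  · simp [pow_succ]
  · intro i' _ hi'
    rw [not_imp_comm.mp (h i') hi', mul_zero]
  · simp

/-- If each row of `U` has at most one nonzero entry, then `(U^σ)ᵀ * U` is diagonal. -/
theorem Matrix.transpose_map_pow_mul_apply_of_ne {n R : Type*} [Fintype n] [Semiring R]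
    (U : Matrix n n R) {k : ℕ} (hk : k ≠ 0)
    (h : ∀ i j j', U i j ≠ 0 → U i j' ≠ 0 → j = j') {j j' : n} (hj : j ≠ j') :
    ((U.map (fun z => z ^ k))ᵀ * U) j j' = 0 := by
  rw [mul_apply]
  refine Finset.sum_eq_zero fun i _ => ?_
  by_cases h₁ : U i j = 0
  · simp [h₁, hk]
  · have h₂ : U i j' = 0 := by
      by_contra h₂
      exact hj (h i j j' h₁ h₂)
    rw [h₂, mul_zero]

/-- Unitaries in Quantum Theory over `F_{1^{r(r+2)}}` : a generalized permutation
matrix `U` with entries `ℓ`-th roots of unity (`ℓ = r(r+2)`) satisfies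
`(U^σ)ᵀ * U = 1`, where `σ : z ↦ z^{r+1}` is applied entrywise, if and only if each
nonzero entry `a` of `U` satisfies `a^{r+2} = 1`. -/
theorem stmt_4 (r m : ℕ) (hr : 1 ≤ r) (hm : 1 ≤ m)
    (U : Matrix (Fin m) (Fin m) ℂ)
    (hrow : ∀ i, ∃! j, U i j ≠ 0)
    (hcol : ∀ j, ∃! i, U i j ≠ 0)
    (hval : ∀ i j, U i j ≠ 0 → (U i j) ^ (r * (r + 2)) = 1) :
    (U.map (fun z => z ^ (r + 1)))ᵀ * U = 1 ↔
      ∀ i j, U i j ≠ 0 → (U i j) ^ (r + 2) = 1 := by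
  constructor
  · intro hU i j hij
    rw [← transpose_map_pow_mul_apply_self U (r + 1)
      fun i' hi' => (hcol j).unique hi' hij, hU, one_apply_eq]
  · intro hU
    ext j j'
    by_cases hj : j = j'
    · subst hj
      obtain ⟨i, hij, huniq⟩ := hcol j
      rw [transpose_map_pow_mul_apply_self U (r + 1) huniq, one_apply_eq]
      exact hU i j hij
    · rw [one_apply_ne hj]
      exact transpose_map_pow_mul_apply_of_ne U r.succ_ne_zero
        (fun i _ _ h h' => (hrow i).unique h h') hj
end

section
/- Let k be a field containing an element α with α² ≠ α, let V be a k-vector space containing a nonzero vector, and let e ∈ V. Then there is no k-linear map U : V ⊗ V → V ⊗ V such that U(ψ ⊗ e) = ψ ⊗ ψ for every ψ ∈ V. -/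
open TensorProduct

/-- No-cloning: over a field `k` containing an element `α` with `α² ≠ α`, for a
`k`-vector space `V` containing a nonzero vector and any blank state `e ∈ V`, there
is no linear map `U : V ⊗ V → V ⊗ V` with `U (ψ ⊗ e) = ψ ⊗ ψ` for all `ψ`. -/
theorem stmt_6 (k : Type*) [Field k] (α : k) (hα : α ^ 2 ≠ α)
    (V : Type*) [AddCommGroup V] [Module k V] (v₀ : V) (hv₀ : v₀ ≠ 0) (e : V) :
    ¬ ∃ U : V ⊗[k] V →ₗ[k] V ⊗[k] V, ∀ ψ : V, U (ψ ⊗ₜ[k] e) = ψ ⊗ₜ[k] ψ := by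
  rintro ⟨U, hU⟩
  have hv : v₀ ⊗ₜ[k] v₀ ≠ 0 := by
    obtain ⟨f, hf⟩ : ∃ f : Module.Dual k V, f v₀ ≠ 0 := by
      by_contra! h
      exact hv₀ ((Module.forall_dual_apply_eq_zero_iff k v₀).mp h)
    intro h
    have := congrArg (LinearMap.mul' k k ∘ₗ TensorProduct.map f f) h
    simp [hf] at this
  have h : α ^ 2 • (v₀ ⊗ₜ[k] v₀) = α • (v₀ ⊗ₜ[k] v₀) := by
    calc α ^ 2 • (v₀ ⊗ₜ[k] v₀) = (α • v₀) ⊗ₜ[k] (α • v₀) := by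
          rw [smul_tmul_smul, sq]
      _ = U ((α • v₀) ⊗ₜ[k] e) := (hU _).symm
      _ = α • (v₀ ⊗ₜ[k] v₀) := by rw [← smul_tmul', map_smul, hU]
  exact hα (smul_left_injective k hv h)
end

section
/- Let m ≥ 1. There exists a permutation π of Fin m × Fin m such that the associated permutation matrix U (with U((i,j),(k,l)) = 1 if (i,j) = π(k,l) and 0 otherwise), which is a unitary complex matrix, satisfies U · (e_i ⊗ e_0) = e_i ⊗ e_i for every i ∈ Fin m, where e_i : Fin m → ℂ is the standard basis vector (e_i)_j = 1 if j = i and 0 otherwise, and (x ⊗ y)(k,l) = x(k)·y(l) for x, y : Fin m → ℂ. -/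
open Matrix

namespace Matrix

variable {n R : Type*} [Fintype n] [DecidableEq n]

theorem of_ite_eq_perm_mulVec [NonAssocSemiring R] (π : Equiv.Perm n) (v : n → R) :
    (Matrix.of fun p q => if p = π q then (1 : R) else 0) *ᵥ v = v ∘ π.symm := by
  ext p
  simp [mulVec, dotProduct, ← Equiv.symm_apply_eq]

theorem of_ite_eq_perm_mem_unitaryGroup [CommRing R] [StarRing R] (π : Equiv.Perm n) :
    (Matrix.of fun p q => if p = π q then (1 : R) else 0) ∈ unitaryGroup n R := by
  rw [mem_unitaryGroup_iff']
  ext p q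
  simp [mul_apply, star_apply, one_apply, apply_ite star, eq_comm]

end Matrix

/-- Simple cloning in Quantum F_un: there is a permutation `π` of `Fin m × Fin m`
whose permutation matrix `U` (a unitary complex matrix) clones every standard basis
state `e_i` with blank state `e_0`: `U · (e_i ⊗ e_0) = e_i ⊗ e_i`. -/
theorem stmt_7 (m : ℕ) (hm : 1 ≤ m) :
    ∃ π : Equiv.Perm (Fin m × Fin m),
      ∀ U : Matrix (Fin m × Fin m) (Fin m × Fin m) ℂ,
        U = Matrix.of (fun p q => if p = π q then (1 : ℂ) else 0) →
        U ∈ Matrix.unitaryGroup (Fin m × Fin m) ℂ ∧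
        ∀ i : Fin m,
          U.mulVec (fun p => (if p.1 = i then (1 : ℂ) else 0) *
              (if p.2 = (⟨0, hm⟩ : Fin m) then (1 : ℂ) else 0)) =
            fun p => (if p.1 = i then (1 : ℂ) else 0) *
              (if p.2 = i then (1 : ℂ) else 0) := by
  refine ⟨Equiv.prodShear (Equiv.refl _) fun k => Equiv.swap ⟨0, hm⟩ k, ?_⟩
  rintro U rfl
  refine ⟨Matrix.of_ite_eq_perm_mem_unitaryGroup _, fun i => ?_⟩
  rw [Matrix.of_ite_eq_perm_mulVec]
  ext ⟨a, b⟩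
  by_cases ha : a = i
  · subst ha
    simp [Equiv.prodShear, Equiv.swap_apply_eq_iff]
  · simp [Equiv.prodShear, ha]
end

section
/- Let m ≥ 1, let U be a complex matrix indexed by (Fin m × Fin m) × (Fin m × Fin m) with exactly one nonzero entry in each row and exactly one nonzero entry in each column, let e : Fin m → ℂ, let i ∈ Fin m, and let c be a nonzero complex number. If U · (e_i ⊗ e) = c • (e_i ⊗ e_i), then e has exactly one nonzero coordinate, where e_i is the i-th standard basis vector and (x ⊗ y)(k,l) = x(k)·y(l). -/
open Matrix

theorem Matrix.mulVec_eq_mul_of_existsUnique_ne_zero {m n R : Type*} [Fintype n]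
    [NonUnitalNonAssocSemiring R] {A : Matrix m n R} {p : m} {q : n}
    (hrow : ∃! q, A p q ≠ 0) (hpq : A p q ≠ 0) (v : n → R) :
    (A *ᵥ v) p = A p q * v q := by
  refine Fintype.sum_eq_single q fun r hr => ?_
  have hpr : A p r = 0 := by
    by_contra hpr
    exact hr (hrow.unique hpr hpq)
  simp only [hpr, zero_mul]

/-- A generalized permutation matrix reflects simplicity of vectors. -/
theorem Matrix.existsUnique_ne_zero_of_mulVec {m n R : Type*} [Fintype n]
    [NonUnitalNonAssocSemiring R] [NoZeroDivisors R] {A : Matrix m n R}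
    (hrow : ∀ p, ∃! q, A p q ≠ 0) (hcol : ∀ q, ∃ p, A p q ≠ 0) {v : n → R}
    (h : ∃! p, (A *ᵥ v) p ≠ 0) : ∃! q, v q ≠ 0 := by
  obtain ⟨p, hp, hp_unique⟩ := h
  obtain ⟨q, hq, hq_unique⟩ := hrow p
  refine ⟨q, ?_, fun r hr => hq_unique r ?_⟩
  · rw [mulVec_eq_mul_of_existsUnique_ne_zero (hrow p) hq] at hp
    exact right_ne_zero_of_mul hp
  · obtain ⟨s, hs⟩ := hcol r
    have hsp : s = p := hp_unique s <| by
      dsimp only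
      rw [mulVec_eq_mul_of_existsUnique_ne_zero (hrow s) hs]
      exact mul_ne_zero hs hr
    exact hsp ▸ hs

/-- If a generalized permutation matrix `U` on `(Fin m × Fin m)` clones the simple
state `e_i` (up to a nonzero scalar `c`) with blank state `e`, then the blank state
`e` must itself be simple (exactly one nonzero coordinate). -/
theorem stmt_9 (m : ℕ) (hm : 1 ≤ m)
    (U : Matrix (Fin m × Fin m) (Fin m × Fin m) ℂ)
    (hrow : ∀ p, ∃! q, U p q ≠ 0)
    (hcol : ∀ q, ∃! p, U p q ≠ 0)
    (e : Fin m → ℂ) (i : Fin m) (c : ℂ) (hc : c ≠ 0)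
    (h : U.mulVec (fun p => (if p.1 = i then (1 : ℂ) else 0) * e p.2) =
      c • fun p => (if p.1 = i then (1 : ℂ) else 0) *
        (if p.2 = i then (1 : ℂ) else 0)) :
    ∃! j, e j ≠ 0 := by
  obtain ⟨q, hq, hq_unique⟩ :=
    existsUnique_ne_zero_of_mulVec hrow (fun q => (hcol q).exists) (by
      rw [h]
      refine ⟨(i, i), by simpa using hc, fun p hp => ?_⟩
      simp only [Pi.smul_apply, smul_eq_mul, ne_eq, mul_eq_zero, ite_eq_right_iff, one_ne_zero,
        imp_false, not_or, not_not] at hp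
      exact Prod.ext hp.2.1 hp.2.2)
  refine ⟨q.2, right_ne_zero_of_mul hq, fun j hj => ?_⟩
  exact congrArg Prod.snd (hq_unique (i, j) (by simpa using hj))
end

section
/- Let m ≥ 1, let U be a complex matrix indexed by (Fin m × Fin m) × (Fin m × Fin m) with exactly one nonzero entry in each row and exactly one nonzero entry in each column, let e : Fin m → ℂ have exactly one nonzero coordinate, let φ : Fin m → ℂ have at least two nonzero coordinates, and let c be any nonzero complex number. Then U · (φ ⊗ e) ≠ c • (φ ⊗ φ), where (x ⊗ y)(k,l) = x(k)·y(l). -/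
open Matrix

/-- For a matrix with exactly one nonzero entry in each row and in each column,
some injection carries the support of `U *ᵥ v` into the support of `v`. -/
theorem exists_injective_of_mulVec_ne_zero {n R : Type*} [Fintype n] [NonUnitalNonAssocSemiring R]
    (U : Matrix n n R) (hrow : ∀ p, ∃! q, U p q ≠ 0) (hcol : ∀ q, ∃! p, U p q ≠ 0) :
    ∃ σ : n → n, Function.Injective σ ∧ ∀ v p, (U *ᵥ v) p ≠ 0 → v (σ p) ≠ 0 := by
  choose σ hσ huniq using hrow
  refine ⟨σ, fun p p' h => (hcol (σ p)).unique (hσ p) (h ▸ hσ p'), fun v p hp hv => hp ?_⟩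
  refine Finset.sum_eq_zero fun q _ => ?_
  change U p q * v q = 0
  by_cases hq : U p q = 0
  · rw [hq, zero_mul]
  · rw [huniq p q hq, hv, mul_zero]

/-- No-cloning in Quantum F_un: a generalized permutation matrix `U` with a simple
blank state `e` cannot clone (even projectively) a state `φ` with at least two
nonzero coordinates. -/
theorem stmt_10 (m : ℕ) (hm : 1 ≤ m)
    (U : Matrix (Fin m × Fin m) (Fin m × Fin m) ℂ)
    (hrow : ∀ p, ∃! q, U p q ≠ 0)
    (hcol : ∀ q, ∃! p, U p q ≠ 0)
    (e : Fin m → ℂ) (he : ∃! j, e j ≠ 0)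
    (φ : Fin m → ℂ) (hφ : ∃ j k : Fin m, j ≠ k ∧ φ j ≠ 0 ∧ φ k ≠ 0)
    (c : ℂ) (hc : c ≠ 0) :
    U.mulVec (fun p => φ p.1 * e p.2) ≠ c • fun p => φ p.1 * φ p.2 := by
  intro h
  obtain ⟨σ, hσ, hsupp⟩ := exists_injective_of_mulVec_ne_zero U hrow hcol
  obtain ⟨j, k, hjk, hj, hk⟩ := hφ
  set S : Finset (Fin m) := Finset.univ.filter (φ · ≠ 0) with hS
  have hmem : ∀ p ∈ S ×ˢ S, φ (σ p).1 ≠ 0 ∧ e (σ p).2 ≠ 0 := by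
    intro p hp
    have hp' : φ p.1 ≠ 0 ∧ φ p.2 ≠ 0 := by simpa [hS] using hp
    refine mul_ne_zero_iff.mp (hsupp (fun p => φ p.1 * e p.2) p ?_)
    rw [h]
    exact mul_ne_zero hc (mul_ne_zero hp'.1 hp'.2)
  have hle : (S ×ˢ S).card ≤ S.card := by
    refine Finset.card_le_card_of_injOn (fun p => (σ p).1) (fun p hp => ?_) fun p hp q hq hpq => ?_
    · simpa [hS] using (hmem p hp).1
    · exact hσ (Prod.ext hpq (he.unique (hmem p hp).2 (hmem q hq).2))
  have hcard : 1 < S.card :=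
    Finset.one_lt_card.mpr ⟨j, by simpa [hS] using hj, k, by simpa [hS] using hk, hjk⟩
  rw [Finset.card_product] at hle
  nlinarith
end

section
/- Let k be a field containing an element α with α² ≠ α, let V be a k-vector space containing a nonzero vector, and let e ∈ V. Then there is no bijective k-linear map U : V ⊗ V → V ⊗ V such that U(ψ ⊗ ψ) = ψ ⊗ e for every ψ ∈ V. -/
open TensorProduct

/-- No-deletion: over a field `k` containing an element `α` with `α² ≠ α`, for a
`k`-vector space `V` containing a nonzero vector and any blank state `e ∈ V`, there
is no bijective linear map `U : V ⊗ V → V ⊗ V` with `U (ψ ⊗ ψ) = ψ ⊗ e` for all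
`ψ`. -/
theorem stmt_11 (k : Type*) [Field k] (α : k) (hα : α ^ 2 ≠ α)
    (V : Type*) [AddCommGroup V] [Module k V] (v₀ : V) (hv₀ : v₀ ≠ 0) (e : V) :
    ¬ ∃ U : V ⊗[k] V →ₗ[k] V ⊗[k] V, Function.Bijective U ∧
      ∀ ψ : V, U (ψ ⊗ₜ[k] ψ) = ψ ⊗ₜ[k] e := by
  rintro ⟨U, hU, h⟩
  have hs : (α ^ 2 - α) • (v₀ ⊗ₜ[k] e) = 0 := by
    have hα_smul := h (α • v₀)
    rw [TensorProduct.smul_tmul_smul, map_smul, h, ← TensorProduct.smul_tmul', ← pow_two]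
      at hα_smul
    rw [sub_smul, hα_smul, sub_self]
  have he : v₀ ⊗ₜ[k] e = 0 := (smul_eq_zero.mp hs).resolve_left (sub_ne_zero.mpr hα)
  have hv : v₀ ⊗ₜ[k] v₀ = 0 := hU.injective (by rw [h, he, map_zero])
  refine hv₀ ((Module.forall_dual_apply_eq_zero_iff k v₀).mp fun f ↦ ?_)
  simpa using congrArg (fun t ↦ TensorProduct.lid k k (TensorProduct.map f f t)) hv
end
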